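/- Let L : ℝ × U × E → ℝ be a regular time dependent Lagrangian of class C², and let X₂ : ℝ × U × E → E be its canonical semispray coefficient. If c : (a,b) → U is a C² curve with c''(s) = X₂(s, c(s), c'(s)) for all s ∈ (a,b) (i.e. c is a geodesic of the Lagrangian semispray), then c satisfies the Euler–Lagrange equation: for every z ∈ E the function s ↦ ∂₃L(s, c(s), c'(s))[z] is differentiable with derivative ∂₂L(s, c(s), c'(s))[z]; equivalently, (d/ds) ∂₃L(s, c(s), c'(s)) = ∂₂L(s, c(s), c'(s)) as curves in the dual space E*. -/

import Mathlib

open Set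

variable {E : Type*} [NormedAddCommGroup E] [NormedSpace ℝ E]

/-- `∂₁L(t,x,y)`, partial derivative of the Lagrangian in the time variable. -/
noncomputable def d1L (L : ℝ → E → E → ℝ) (t : ℝ) (x y : E) : ℝ :=
  deriv (fun t' => L t' x y) t

/-- `∂₂L(t,x,y)`, partial Fréchet derivative of the Lagrangian in the base variable. -/
noncomputable def d2L (L : ℝ → E → E → ℝ) (t : ℝ) (x y : E) : E →L[ℝ] ℝ :=
  fderiv ℝ (fun x' => L t x' y) x

/-- `∂₃L(t,x,y)`, partial Fréchet derivative of the Lagrangian in the fiber variable. -/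
noncomputable def d3L (L : ℝ → E → E → ℝ) (t : ℝ) (x y : E) : E →L[ℝ] ℝ :=
  fderiv ℝ (fun y' => L t x y') y

/-- `d13L L t x y z` is `∂₁∂₃L(t,x,y)[z]`, the time derivative of `∂₃L(·,x,y)z`. -/
noncomputable def d13L (L : ℝ → E → E → ℝ) (t : ℝ) (x y : E) : E →L[ℝ] ℝ :=
  deriv (fun t' => d3L L t' x y) t

/-- `d23L L t x y a z` is `∂₂∂₃L(t,x,y)[z,a]`, the derivative in base direction `a` of
`∂₃L(t,·,y)z`. -/
noncomputable def d23L (L : ℝ → E → E → ℝ) (t : ℝ) (x y : E) : E →L[ℝ] E →L[ℝ] ℝ :=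
  fderiv ℝ (fun x' => d3L L t x' y) x

/-- `d33L L t x y w z` is `∂₃²L(t,x,y)[z,w]`, the derivative in fiber direction `w` of
`∂₃L(t,x,·)z`. -/
noncomputable def d33L (L : ℝ → E → E → ℝ) (t : ℝ) (x y : E) : E →L[ℝ] E →L[ℝ] ℝ :=
  fderiv ℝ (fun y' => d3L L t x y') y

/-- A time dependent Lagrangian `L` is regular on `U` if it is C² and at every point of
`ℝ × U × E` the map `X ↦ ∂₃²L(v)[·, X]` is a continuous linear isomorphism `E → E*`. -/
def RegularLagrangian (L : ℝ → E → E → ℝ) (U : Set E) : Prop :=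
  ContDiffOn ℝ 2 (fun p : ℝ × E × E => L p.1 p.2.1 p.2.2) (univ ×ˢ U ×ˢ univ) ∧
  ∀ t : ℝ, ∀ x ∈ U, ∀ y : E,
    ∃ e : E ≃L[ℝ] (E →L[ℝ] ℝ), ∀ X : E, e X = d33L L t x y X

theorem hasFDerivAt_prodMk_fiber (t : ℝ) (x y : E) :
    HasFDerivAt (fun y' : E => (t, x, y'))
      ((ContinuousLinearMap.inr ℝ ℝ (E × E)).comp (ContinuousLinearMap.inr ℝ E E)) y :=
  (hasFDerivAt_prodMk_right t (x, y)).comp (f := fun y' => (x, y')) y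
    (hasFDerivAt_prodMk_right x y)

theorem hasFDerivAt_prodMk_base (t : ℝ) (x y : E) :
    HasFDerivAt (fun x' : E => (t, x', y))
      ((ContinuousLinearMap.inr ℝ ℝ (E × E)).comp (ContinuousLinearMap.inl ℝ E E)) x :=
  (hasFDerivAt_prodMk_right t (x, y)).comp (f := fun x' => (x', y)) x
    (hasFDerivAt_prodMk_left x y)

theorem d3L_eq_fderiv_comp {L : ℝ → E → E → ℝ} {t : ℝ} {x y : E}
    (h : DifferentiableAt ℝ (fun p : ℝ × E × E => L p.1 p.2.1 p.2.2) (t, x, y)) :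
    d3L L t x y = (fderiv ℝ (fun p : ℝ × E × E => L p.1 p.2.1 p.2.2) (t, x, y)).comp
      ((ContinuousLinearMap.inr ℝ ℝ (E × E)).comp (ContinuousLinearMap.inr ℝ E E)) :=
  (h.hasFDerivAt.comp (f := fun y' => (t, x, y')) y (hasFDerivAt_prodMk_fiber t x y)).fderiv

theorem differentiableAt_d3L {L : ℝ → E → E → ℝ} {t : ℝ} {x y : E}
    (h : ContDiffAt ℝ 2 (fun p : ℝ × E × E => L p.1 p.2.1 p.2.2) (t, x, y)) :
    DifferentiableAt ℝ (fun p : ℝ × E × E => d3L L p.1 p.2.1 p.2.2) (t, x, y) := by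
  have hF : DifferentiableAt ℝ
      (fderiv ℝ (fun p : ℝ × E × E => L p.1 p.2.1 p.2.2)) (t, x, y) :=
    (h.fderiv_right (m := 1) (by norm_num)).differentiableAt (by norm_num)
  refine (hF.clm_comp (differentiableAt_const
    ((ContinuousLinearMap.inr ℝ ℝ (E × E)).comp
      (ContinuousLinearMap.inr ℝ E E)))).congr_of_eventuallyEq ?_
  filter_upwards [h.eventually (by simp)] with p hp
  exact d3L_eq_fderiv_comp (hp.differentiableAt (by norm_num))

/-- The chain rule for a differentiable function of three variables along a curve, in terms of
its partial derivatives. -/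
theorem hasDerivAt_along_curve {F : Type*} [NormedAddCommGroup F] [NormedSpace ℝ F]
    {P : ℝ → E → E → F} {s : ℝ} {u v : ℝ → E} {u' v' : E}
    (hP : DifferentiableAt ℝ (fun p : ℝ × E × E => P p.1 p.2.1 p.2.2) (s, u s, v s))
    (hu : HasDerivAt u u' s) (hv : HasDerivAt v v' s) :
    HasDerivAt (fun r => P r (u r) (v r))
      (deriv (fun t => P t (u s) (v s)) s + fderiv ℝ (fun x => P s x (v s)) (u s) u' +
        fderiv ℝ (fun y => P s (u s) y) (v s) v') s := by
  have h1 := (hP.hasFDerivAt.comp_hasDerivAt s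
    ((hasDerivAt_id s).prodMk (hasDerivAt_const s (u s, v s)))).deriv
  have h2 := (hP.hasFDerivAt.comp (f := fun x => (s, x, v s)) (u s)
    (hasFDerivAt_prodMk_base s (u s) (v s))).fderiv
  have h3 := (hP.hasFDerivAt.comp (f := fun y => (s, u s, y)) (v s)
    (hasFDerivAt_prodMk_fiber s (u s) (v s))).fderiv
  simp only [Function.comp_def, id_eq] at h1 h2 h3
  rw [h1, h2, h3]
  refine (hP.hasFDerivAt.comp_hasDerivAt s
    ((hasDerivAt_id s).prodMk (hu.prodMk hv))).congr_deriv ?_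
  simp [← map_add]

/-- Geodesics of the canonical semispray of a regular time dependent
Lagrangian satisfy the Euler–Lagrange equation. -/
theorem geodesics_satisfy_euler_lagrange
    {E : Type*} [NormedAddCommGroup E] [NormedSpace ℝ E] [CompleteSpace E]
    (U : Set E) (hU : IsOpen U) (L : ℝ → E → E → ℝ)
    (hreg : RegularLagrangian L U)
    (X₂ : ℝ → E → E → E)
    (hX₂ : ∀ t : ℝ, ∀ x ∈ U, ∀ y z : E,
      d33L L t x y (X₂ t x y) z
        = d2L L t x y z - d13L L t x y z - d23L L t x y y z)
    (a b : ℝ) (c : ℝ → E)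
    (hcU : MapsTo c (Ioo a b) U) (hc : ContDiffOn ℝ 2 c (Ioo a b))
    (hgeo : ∀ s ∈ Ioo a b, deriv (deriv c) s = X₂ s (c s) (deriv c s)) :
    ∀ s ∈ Ioo a b,
      (∀ z : E, HasDerivAt (fun r => d3L L r (c r) (deriv c r) z)
        (d2L L s (c s) (deriv c s) z) s) ∧
      HasDerivAt (fun r => d3L L r (c r) (deriv c r))
        (d2L L s (c s) (deriv c s)) s := by
  intro s hs
  have hc2 : ContDiffAt ℝ 2 c s := hc.contDiffAt (isOpen_Ioo.mem_nhds hs)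
  have hc' : DifferentiableAt ℝ (deriv c) s :=
    (((contDiffOn_succ_iff_deriv_of_isOpen (n := 1) isOpen_Ioo).1
      (by simpa [one_add_one_eq_two] using hc)).2.2.differentiableOn
        (by norm_num)).differentiableAt (isOpen_Ioo.mem_nhds hs)
  have hL : ContDiffAt ℝ 2 (fun p : ℝ × E × E => L p.1 p.2.1 p.2.2) (s, c s, deriv c s) :=
    hreg.1.contDiffAt ((isOpen_univ.prod (hU.prod isOpen_univ)).mem_nhds
      ⟨mem_univ _, hcU hs, mem_univ _⟩)
  have key : HasDerivAt (fun r => d3L L r (c r) (deriv c r)) (d2L L s (c s) (deriv c s)) s := by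
    refine (hasDerivAt_along_curve (differentiableAt_d3L hL)
      (hc2.differentiableAt (by norm_num)).hasDerivAt hc'.hasDerivAt).congr_deriv ?_
    ext z
    have h := hX₂ s (c s) (hcU hs) (deriv c s) z
    rw [← hgeo s hs] at h
    change d13L L s (c s) (deriv c s) z + d23L L s (c s) (deriv c s) (deriv c s) z +
      d33L L s (c s) (deriv c s) (deriv (deriv c) s) z = _
    rw [h]
    ring
  exact ⟨fun z => key.clm_apply (hasDerivAt_const s z) |>.congr_deriv (by simp), key⟩
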